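/- arXiv:1410.6950 — 2 statements merged into one kernel-verified Lean document; each statement's English description precedes it below -/
import Mathlib

section
/- Let T₁,…,Tₙ be isometries on H with Σᵢ TᵢTᵢ* ≤ I_H, let M = Ran(Σᵢ TᵢTᵢ*) and P the orthogonal projection onto M⊥. Suppose Y₁ is a partial isometry with initial space M, Y₂,…,Yₙ are isometries, and Σᵢ YᵢYᵢ* = I_H. Define X₁ = P, Xᵢ = 0 for i ≥ 2, and T̃ᵢ = [[Tᵢ, Xᵢ],[0, Yᵢ]] on H ⊕ H. Then each T̃ᵢ is an isometry and Σᵢ T̃ᵢT̃ᵢ* = I_{H⊕H}. -/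
/-- Let `T₁,…,Tₙ` be isometries on `H` with `Σᵢ TᵢTᵢ* ≤ I` and let
`Q = Σᵢ TᵢTᵢ*` (the projection onto `M = Ran Q`, so the projection onto `M⊥` is `I - Q`).
Suppose `Y₁` is a partial isometry with initial space `M` (`Y₁*Y₁ = Q`), the other `Yᵢ`
are isometries, and `Σᵢ YᵢYᵢ* = I`. Put `X₁ = I - Q`, `Xᵢ = 0` for `i ≥ 2`, and let
`T̃ᵢ = [[Tᵢ, Xᵢ], [0, Yᵢ]]` on `H ⊕ H`. Then each `T̃ᵢ` is an isometry and
`Σᵢ T̃ᵢT̃ᵢ* = I_{H⊕H}`. -/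
theorem block_dilation_is_cuntz_family
    {H : Type*} [NormedAddCommGroup H] [InnerProductSpace ℂ H] [CompleteSpace H]
    {n : ℕ} [NeZero n] (T Y X : Fin n → H →L[ℂ] H)
    (hiso : ∀ i, (ContinuousLinearMap.adjoint (T i)) ∘L T i = 1)
    (hle : (1 - ∑ i, T i ∘L ContinuousLinearMap.adjoint (T i)).IsPositive)
    (hY0 : (ContinuousLinearMap.adjoint (Y 0)) ∘L Y 0
        = ∑ i, T i ∘L ContinuousLinearMap.adjoint (T i))
    (hYi : ∀ i, i ≠ 0 → (ContinuousLinearMap.adjoint (Y i)) ∘L Y i = 1)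
    (hYsum : ∑ i, Y i ∘L ContinuousLinearMap.adjoint (Y i) = 1)
    (hX0 : X 0 = 1 - ∑ i, T i ∘L ContinuousLinearMap.adjoint (T i))
    (hXi : ∀ i, i ≠ 0 → X i = 0)
    (Tt : Fin n → (WithLp 2 (H × H) →L[ℂ] WithLp 2 (H × H)))
    (hTt : ∀ i (x y : H),
      (WithLp.equiv 2 (H × H)) (Tt i ((WithLp.equiv 2 (H × H)).symm (x, y)))
        = (T i x + X i y, Y i y)) :
    (∀ i, (ContinuousLinearMap.adjoint (Tt i)) ∘L Tt i = 1) ∧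
      (∑ i, Tt i ∘L ContinuousLinearMap.adjoint (Tt i)) = 1 := by
  classical
  have h1 : ∀ i z, ContinuousLinearMap.adjoint (T i) (T i z) = z := fun i z => by
    simpa using congrArg (fun A : H →L[ℂ] H => A z) (hiso i)
  obtain ⟨Q, hQ⟩ : ∃ Q : H →L[ℂ] H,
      Q = ∑ i, T i ∘L ContinuousLinearMap.adjoint (T i) := ⟨_, rfl⟩
  rw [← hQ] at hle hY0 hX0
  have hQa : ∀ z, Q z = ∑ i, T i (ContinuousLinearMap.adjoint (T i) z) := fun z => by
    simp [hQ, ContinuousLinearMap.sum_apply]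
  have hQadj : ContinuousLinearMap.adjoint Q = Q := by
    rw [← hY0, ContinuousLinearMap.adjoint_comp, ContinuousLinearMap.adjoint_adjoint]
  have hort : ∀ i j z, i ≠ j → ContinuousLinearMap.adjoint (T i) (T j z) = 0 := by
    intro i j z hij
    have hp := hle.re_inner_nonneg_left (T j z)
    have hn : ∀ k w, RCLike.re (inner ℂ (T k (ContinuousLinearMap.adjoint (T k) w)) w)
        = ‖ContinuousLinearMap.adjoint (T k) w‖ ^ 2 := by
      intro k w
      rw [← ContinuousLinearMap.adjoint_inner_right, inner_self_eq_norm_sq]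
    have hjj : RCLike.re (inner ℂ (T j z) (T j z)) = ‖z‖ ^ 2 := by
      rw [← ContinuousLinearMap.adjoint_inner_right, h1, inner_self_eq_norm_sq]
    have he : (1 - Q) (T j z) = T j z - Q (T j z) := by simp
    rw [he, inner_sub_left, map_sub, hjj, hQa, sum_inner, map_sum] at hp
    simp only [hn] at hp
    rw [← Finset.add_sum_erase _ _ (Finset.mem_univ j), h1] at hp
    have hle' := Finset.single_le_sum
      (f := fun k => ‖ContinuousLinearMap.adjoint (T k) (T j z)‖ ^ 2)
      (fun k _ => sq_nonneg _) (Finset.mem_erase.2 ⟨hij, Finset.mem_univ i⟩)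
    have h0 : ‖ContinuousLinearMap.adjoint (T i) (T j z)‖ ^ 2 = 0 :=
      le_antisymm (by linarith) (sq_nonneg _)
    simpa using h0
  have hQT : ∀ j z, Q (T j z) = T j z := by
    intro j z
    rw [hQa, Finset.sum_eq_single j, h1]
    · intro i _ hij
      rw [hort i j z hij, map_zero]
    · simp
  have hTQ : ∀ j z, ContinuousLinearMap.adjoint (T j) (Q z)
      = ContinuousLinearMap.adjoint (T j) z := by
    intro j z
    refine ext_inner_right ℂ fun w => ?_
    rw [ContinuousLinearMap.adjoint_inner_left, ContinuousLinearMap.adjoint_inner_left,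
      ← hQadj, ContinuousLinearMap.adjoint_inner_left, hQT]
  have hQQ : ∀ z, Q (Q z) = Q z := by
    intro z
    rw [hQa (Q z), hQa z]
    refine Finset.sum_congr rfl fun i _ => ?_
    rw [← hQa z, hTQ]
  have hYY : ∀ z, ContinuousLinearMap.adjoint (Y 0) (Y 0 z) = Q z := fun z => by
    simpa using congrArg (fun A : H →L[ℂ] H => A z) hY0
  have hYYi : ∀ i, i ≠ 0 → ∀ z, ContinuousLinearMap.adjoint (Y i) (Y i z) = z :=
    fun i hi z => by simpa using congrArg (fun A : H →L[ℂ] H => A z) (hYi i hi)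
  have hYs : ∀ z, ∑ i, Y i (ContinuousLinearMap.adjoint (Y i) z) = z := fun z => by
    simpa [ContinuousLinearMap.sum_apply] using congrArg (fun A : H →L[ℂ] H => A z) hYsum
  have hYQ : ∀ z, Y 0 (Q z) = Y 0 z := by
    intro z
    rw [← sub_eq_zero, ← map_sub, ← inner_self_eq_zero (𝕜 := ℂ),
      ← ContinuousLinearMap.adjoint_inner_right, hYY, map_sub, hQQ, sub_self, inner_zero_right]
  have hQY : ∀ z, Q (ContinuousLinearMap.adjoint (Y 0) z)
      = ContinuousLinearMap.adjoint (Y 0) z := by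
    intro z
    refine ext_inner_right ℂ fun w => ?_
    rw [← hQadj, ContinuousLinearMap.adjoint_inner_left, ContinuousLinearMap.adjoint_inner_left,
      ContinuousLinearMap.adjoint_inner_left, hYQ]
  have hXadj : ∀ i, ContinuousLinearMap.adjoint (X i) = X i := by
    intro i
    by_cases hi : i = 0
    · subst hi
      rw [hX0]
      exact hle.isSelfAdjoint.adjoint_eq
    · rw [hXi i hi, map_zero]
  have hX0a : ∀ z, X 0 z = z - Q z := fun z => by simp [hX0]
  have hT : ∀ i (x y : H), Tt i (WithLp.toLp 2 (x, y))
      = WithLp.toLp 2 (T i x + X i y, Y i y) := by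
    intro i x y
    exact (WithLp.equiv 2 (H × H)).injective (hTt i x y)
  have hTa : ∀ i (x y : H), ContinuousLinearMap.adjoint (Tt i) (WithLp.toLp 2 (x, y))
      = WithLp.toLp 2 (ContinuousLinearMap.adjoint (T i) x,
          X i x + ContinuousLinearMap.adjoint (Y i) y) := by
    intro i x y
    refine ext_inner_right ℂ fun w => ?_
    obtain ⟨⟨a, b⟩⟩ := w
    rw [ContinuousLinearMap.adjoint_inner_left, hT]
    simp only [WithLp.prod_inner_apply, inner_add_left, inner_add_right,
      ContinuousLinearMap.adjoint_inner_left]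
    rw [← ContinuousLinearMap.adjoint_inner_left (X i), hXadj]
    ring
  constructor
  · intro i
    ext1 w
    obtain ⟨⟨x, y⟩⟩ := w
    rw [ContinuousLinearMap.comp_apply, hT, hTa, ContinuousLinearMap.one_apply]
    by_cases hi : i = 0
    · subst hi
      congr 2
      · rw [map_add, h1, hX0a, map_sub, hTQ, sub_self, add_zero]
      · rw [map_add, hX0a, hX0a, hX0a, hYY, hQT, map_sub, hQQ]
        abel
    · simp [hXi i hi, h1, hYYi i hi]
  · ext1 w
    obtain ⟨⟨x, y⟩⟩ := w
    rw [ContinuousLinearMap.sum_apply, ContinuousLinearMap.one_apply]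
    have hs : ∀ i, (Tt i ∘L ContinuousLinearMap.adjoint (Tt i)) (WithLp.toLp 2 (x, y))
        = WithLp.toLp 2 (T i (ContinuousLinearMap.adjoint (T i) x) + (if i = 0 then x - Q x else 0),
            Y i (ContinuousLinearMap.adjoint (Y i) y)) := by
      intro i
      rw [ContinuousLinearMap.comp_apply, hTa, hT]
      by_cases hi : i = 0
      · subst hi
        rw [if_pos rfl]
        congr 2
        · congr 1
          rw [map_add, hX0a, hX0a, hX0a, map_sub, hQQ, hQY]
          abel
        · rw [map_add, hX0a, map_sub, hYQ, sub_self, zero_add]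
      · simp [hXi i hi, hi]
    simp only [hs]
    rw [← WithLp.toLp_sum]
    congr 1
    rw [Prod.ext_iff, Prod.fst_sum, Prod.snd_sum]
    refine ⟨?_, hYs y⟩
    simp only [Finset.sum_add_distrib, ← hQa, Finset.sum_ite_eq', Finset.mem_univ, if_true]
    abel
end

section
/- Let S be an operator system and J ⊆ S a kernel. Define C_n ⊆ M_n(S/J) as the set of (xᵢⱼ + J) such that for each ε > 0 there exists (kᵢⱼ) ∈ M_n(J) with ε·1_S ⊗ I_n + (xᵢⱼ + kᵢⱼ) ∈ M_n(S)⁺. Then (S/J, {C_n}, 1_S + J) is a matrix-ordered *-vector space with Archimedean matrix order unit 1_S + J, and the quotient map q : S → S/J is unital and completely positive. -/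
open scoped Matrix

/-- The quotient matrix cone `C_m` of `M_m(S/J)`, described on representatives: a matrix
`x ∈ M_m(A)` with entries in `S` represents an element of `C_m` iff for every `ε > 0`
there is `k ∈ M_m(J)` with `ε·1 ⊗ I_m + (x + k)` positive in `M_m(A)` (positivity being
the C*-characterization `· = Yᴴ * Y`). -/
def quotCone {A : Type*} [NormedRing A] [StarRing A] [NormedAlgebra ℂ A]
    (S J : Submodule ℂ A) (m : ℕ) (x : Matrix (Fin m) (Fin m) A) : Prop :=
  (∀ i j, x i j ∈ S) ∧
    ∀ ε : ℝ, 0 < ε → ∃ k : Matrix (Fin m) (Fin m) A,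
      (∀ i j, k i j ∈ J) ∧
      ∃ Y : Matrix (Fin m) (Fin m) A,
        (ε : ℂ) • (1 : Matrix (Fin m) (Fin m) A) + (x + k) = Yᴴ * Y

set_option linter.unusedSectionVars false

section AbstractFacts

variable {C : Type*} [CStarAlgebra C]

theorem sq_add (x y : C) (hx : ∃ Y : C, x = star Y * Y) (hy : ∃ Y : C, y = star Y * Y) :
    ∃ Y : C, x + y = star Y * Y := by
  let _ : PartialOrder C := CStarAlgebra.spectralOrder C
  have _ : StarOrderedRing C := CStarAlgebra.spectralOrderedRing C
  rw [← CStarAlgebra.nonneg_iff_eq_star_mul_self] at *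
  exact add_nonneg hx hy

theorem sq_unit (x : C) (hx : star x = x) :
    ∃ r : ℝ, 0 < r ∧ ∃ Y : C, (r : ℂ) • (1 : C) + x = star Y * Y := by
  let _ : PartialOrder C := CStarAlgebra.spectralOrder C
  have _ : StarOrderedRing C := CStarAlgebra.spectralOrderedRing C
  refine ⟨‖x‖ + 1, by positivity, ?_⟩
  rw [← CStarAlgebra.nonneg_iff_eq_star_mul_self]
  have h1 := IsSelfAdjoint.neg_algebraMap_norm_le_self (a := x) hx
  have h2 : (0 : C) ≤ 1 := zero_le_one
  have h3 : algebraMap ℝ C ‖x‖ = ((‖x‖ : ℝ) : ℂ) • (1 : C) := by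
    rw [Algebra.algebraMap_eq_smul_one]; simp
  rw [h3] at h1
  have h4 := add_nonneg (neg_le_iff_add_nonneg.1 h1) h2
  convert h4 using 1
  push_cast
  rw [add_smul, one_smul]
  abel

theorem sq_proper (x : C)
    (h : ∀ ε : ℝ, 0 < ε → ∃ Y : C, (ε : ℂ) • (1 : C) + x = star Y * Y)
    (h' : ∀ ε : ℝ, 0 < ε → ∃ Y : C, (ε : ℂ) • (1 : C) + -x = star Y * Y) : x = 0 := by
  let _ : PartialOrder C := CStarAlgebra.spectralOrder C
  have _ : StarOrderedRing C := CStarAlgebra.spectralOrderedRing C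
  simp_rw [← CStarAlgebra.nonneg_iff_eq_star_mul_self] at *
  have key : ∀ y : C, (∀ ε : ℝ, 0 < ε → 0 ≤ (ε : ℂ) • (1 : C) + y) → 0 ≤ y := by
    intro y hy
    have hc : Continuous fun ε : ℝ => (ε : ℂ) • (1 : C) + y := by fun_prop
    have ht := (hc.tendsto 0).mono_left (nhdsWithin_le_nhds (s := Set.Ioi 0))
    simp only [Complex.ofReal_zero, zero_smul, zero_add] at ht
    refine ge_of_tendsto ht ?_
    filter_upwards [self_mem_nhdsWithin] with ε hε using hy ε hε
  exact le_antisymm (neg_nonneg.1 (key _ h')) (key _ h)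

end AbstractFacts

section MatrixFacts

variable {A : Type*} [NormedRing A] [StarRing A] [CStarRing A]
    [NormedAlgebra ℂ A] [StarModule ℂ A] [CompleteSpace A]

/-- Positivity of matrices. -/
def MPos {A : Type*} [NormedRing A] [StarRing A] {m : ℕ} (x : Matrix (Fin m) (Fin m) A) : Prop :=
  ∃ Y : Matrix (Fin m) (Fin m) A, x = Yᴴ * Y

theorem MPos.add {m : ℕ} {x y : Matrix (Fin m) (Fin m) A} (hx : MPos x) (hy : MPos y) :
    MPos (x + y) := by
  let _ : CStarAlgebra A := {}
  let _ : PartialOrder A := CStarAlgebra.spectralOrder A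
  have _ : StarOrderedRing A := CStarAlgebra.spectralOrderedRing A
  exact sq_add (C := CStarMatrix (Fin m) (Fin m) A) x y hx hy

theorem MPos.unit {m : ℕ} {x : Matrix (Fin m) (Fin m) A} (hx : xᴴ = x) :
    ∃ r : ℝ, 0 < r ∧ MPos ((r : ℂ) • (1 : Matrix (Fin m) (Fin m) A) + x) := by
  let _ : CStarAlgebra A := {}
  let _ : PartialOrder A := CStarAlgebra.spectralOrder A
  have _ : StarOrderedRing A := CStarAlgebra.spectralOrderedRing A
  exact sq_unit (C := CStarMatrix (Fin m) (Fin m) A) x hx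

theorem MPos.proper {m : ℕ} {x : Matrix (Fin m) (Fin m) A}
    (h : ∀ ε : ℝ, 0 < ε → MPos ((ε : ℂ) • (1 : Matrix (Fin m) (Fin m) A) + x))
    (h' : ∀ ε : ℝ, 0 < ε → MPos ((ε : ℂ) • (1 : Matrix (Fin m) (Fin m) A) + -x)) : x = 0 := by
  let _ : CStarAlgebra A := {}
  let _ : PartialOrder A := CStarAlgebra.spectralOrder A
  have _ : StarOrderedRing A := CStarAlgebra.spectralOrderedRing A
  exact sq_proper (C := CStarMatrix (Fin m) (Fin m) A) x h h'

theorem MPos.smul {m : ℕ} {x : Matrix (Fin m) (Fin m) A} (hx : MPos x) {r : ℝ} (hr : 0 ≤ r) :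
    MPos ((r : ℂ) • x) := by
  obtain ⟨Y, rfl⟩ := hx
  refine ⟨((Real.sqrt r : ℝ) : ℂ) • Y, ?_⟩
  rw [Matrix.conjTranspose_smul, Matrix.smul_mul, Matrix.mul_smul, smul_smul]
  simp only [RCLike.star_def, Complex.conj_ofReal]
  rw [← Complex.ofReal_mul, Real.mul_self_sqrt hr]

theorem MPos.one {m : ℕ} : MPos (1 : Matrix (Fin m) (Fin m) A) := ⟨1, by simp⟩

theorem MPos.isHerm {m : ℕ} {x : Matrix (Fin m) (Fin m) A} (h : MPos x) : xᴴ = x := by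
  obtain ⟨Y, rfl⟩ := h
  simp

theorem MPos.sum {m : ℕ} {ι : Type*} (s : Finset ι) (f : ι → Matrix (Fin m) (Fin m) A)
    (h : ∀ i ∈ s, MPos (f i)) : MPos (∑ i ∈ s, f i) := by
  classical
  induction s using Finset.induction_on with
  | empty => exact ⟨0, by simp⟩
  | insert a s ha ih =>
    rw [Finset.sum_insert ha]
    exact (h a (by simp)).add (ih fun i hi => h i (by simp [hi]))

theorem MPos.rect {m m' : ℕ} (Y : Matrix (Fin m) (Fin m') A) : MPos (Yᴴ * Y) := by
  rcases m' with _ | n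
  · exact ⟨0, by ext i; exact i.elim0⟩
  have : Yᴴ * Y = ∑ i, (Matrix.of fun a b => if a = 0 then Y i b else 0 :
      Matrix (Fin (n+1)) (Fin (n+1)) A)ᴴ *
      (Matrix.of fun a b => if a = 0 then Y i b else 0) := by
    ext a b
    simp [Matrix.mul_apply, Matrix.sum_apply, apply_ite star]
  rw [this]
  exact MPos.sum _ _ fun i _ => ⟨_, rfl⟩

theorem MPos.conj {m m' : ℕ} {x : Matrix (Fin m) (Fin m) A} (hx : MPos x)
    (α : Matrix (Fin m) (Fin m') A) : MPos (αᴴ * x * α) := by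
  obtain ⟨Y, rfl⟩ := hx
  have := MPos.rect (Y * α)
  rwa [Matrix.conjTranspose_mul, Matrix.mul_assoc, ← Matrix.mul_assoc Yᴴ,
    ← Matrix.mul_assoc αᴴ] at this

theorem conj_mem (T : Submodule ℂ A) {m m' : ℕ} {x : Matrix (Fin m) (Fin m) A}
    (hx : ∀ i j, x i j ∈ T) (α : Matrix (Fin m) (Fin m') ℂ) (i j : Fin m') :
    ((α.map (algebraMap ℂ A))ᴴ * x * α.map (algebraMap ℂ A)) i j ∈ T := by
  simp only [Matrix.mul_apply, Matrix.conjTranspose_apply, Matrix.map_apply]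
  refine T.sum_mem fun k _ => ?_
  rw [Finset.sum_mul]
  refine T.sum_mem fun l _ => ?_
  rw [← algebraMap_star_comm, ← Algebra.commutes, ← Algebra.smul_def, ← Algebra.smul_def]
  exact T.smul_mem _ (T.smul_mem _ (hx _ _))

end MatrixFacts

/-- Let `S` be a (concrete) operator system in a unital C*-algebra `A`
and `J ⊆ S` a kernel (`J = ker φ` for a unital completely positive `φ : S → B`). With the
quotient cones `C_m` of `quotCone`, `(S/J, {C_m}, 1 + J)` is a matrix-ordered *-vector
space with Archimedean matrix order unit `1 + J`, and the quotient map `q : S → S/J` is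
unital and completely positive. On representatives this reads: the cones are closed
under addition and nonnegative real scaling, compatible with conjugation by scalar
matrices `α* C_m α ⊆ C_{m'}`, consist of hermitian-mod-`J` elements, are proper
(`C_m ∩ −C_m = {0}` in the quotient), `1 + J` is an Archimedean matrix order unit, and
every positive matrix over `S` lies in the cone (complete positivity of `q`; `q` is
unital since `q(1) = 1 + J` is the distinguished unit). -/
theorem quotient_operator_system_structure
    {A : Type*} [NormedRing A] [StarRing A] [CStarRing A]
    [NormedAlgebra ℂ A] [StarModule ℂ A] [CompleteSpace A]
    {B : Type*} [NormedRing B] [StarRing B] [CStarRing B]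
    [NormedAlgebra ℂ B] [StarModule ℂ B] [CompleteSpace B]
    (S J : Submodule ℂ A)
    (hS1 : (1 : A) ∈ S) (hSstar : ∀ x ∈ S, star x ∈ S) (hJS : J ≤ S)
    (φ : S →ₗ[ℂ] B)
    (hφ1 : φ ⟨1, hS1⟩ = 1)
    (hφcp : ∀ (m : ℕ) (x : Matrix (Fin m) (Fin m) A) (hx : ∀ i j, x i j ∈ S),
      (∃ Y : Matrix (Fin m) (Fin m) A, x = Yᴴ * Y) →
      ∃ Z : Matrix (Fin m) (Fin m) B,
        (Matrix.of fun i j => φ ⟨x i j, hx i j⟩) = Zᴴ * Z)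
    (hker : ∀ (x : A) (hx : x ∈ S), φ ⟨x, hx⟩ = 0 ↔ x ∈ J) :
    -- cones are closed under addition
    (∀ (m : ℕ) (x y : Matrix (Fin m) (Fin m) A),
      quotCone S J m x → quotCone S J m y → quotCone S J m (x + y)) ∧
    -- cones are closed under nonnegative real scaling
    (∀ (m : ℕ) (r : ℝ) (x : Matrix (Fin m) (Fin m) A),
      0 ≤ r → quotCone S J m x → quotCone S J m ((r : ℂ) • x)) ∧
    -- compatibility: α* C_m α ⊆ C_{m'} for scalar matrices α ∈ M_{m,m'}(ℂ)
    (∀ (m m' : ℕ) (α : Matrix (Fin m) (Fin m') ℂ) (x : Matrix (Fin m) (Fin m) A),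
      quotCone S J m x →
      quotCone S J m' ((α.map (algebraMap ℂ A))ᴴ * x * α.map (algebraMap ℂ A))) ∧
    -- elements of the cones are hermitian modulo J
    (∀ (m : ℕ) (x : Matrix (Fin m) (Fin m) A),
      quotCone S J m x → ∀ i j, x i j - star (x j i) ∈ J) ∧
    -- properness: C_m ∩ (−C_m) = {0} in the quotient
    (∀ (m : ℕ) (x : Matrix (Fin m) (Fin m) A),
      quotCone S J m x → quotCone S J m (-x) → ∀ i j, x i j ∈ J) ∧
    -- 1 + J is a matrix order unit
    (∀ (m : ℕ) (x : Matrix (Fin m) (Fin m) A),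
      (∀ i j, x i j ∈ S) → (∀ i j, star (x j i) = x i j) →
      ∃ r : ℝ, 0 < r ∧ quotCone S J m ((r : ℂ) • (1 : Matrix (Fin m) (Fin m) A) + x)) ∧
    -- the matrix order unit 1 + J is Archimedean
    (∀ (m : ℕ) (x : Matrix (Fin m) (Fin m) A),
      (∀ i j, x i j ∈ S) →
      (∀ ε : ℝ, 0 < ε →
        quotCone S J m ((ε : ℂ) • (1 : Matrix (Fin m) (Fin m) A) + x)) →
      quotCone S J m x) ∧
    -- the quotient map q is (completely) positive: M_m(S)⁺ maps into C_m
    (∀ (m : ℕ) (x : Matrix (Fin m) (Fin m) A),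
      (∀ i j, x i j ∈ S) → (∃ Y : Matrix (Fin m) (Fin m) A, x = Yᴴ * Y) →
      quotCone S J m x) := by
  have hone : ∀ (m : ℕ) (i j : Fin m), (1 : Matrix (Fin m) (Fin m) A) i j ∈ S := by
    intro m i j
    rw [Matrix.one_apply]
    split_ifs
    · exact hS1
    · exact S.zero_mem
  have hpos : ∀ (m : ℕ) (x : Matrix (Fin m) (Fin m) A),
      (∀ i j, x i j ∈ S) → MPos x → quotCone S J m x := by
    intro m x hx h
    refine ⟨hx, fun ε hε => ⟨0, fun i j => J.zero_mem, ?_⟩⟩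
    rw [add_zero]
    exact (MPos.one.smul hε.le).add h
  -- the map at matrix level
  have hφext : ∀ (a b : A) (ha : a ∈ S) (hb : b ∈ S), a = b → φ ⟨a, ha⟩ = φ ⟨b, hb⟩ := by
    rintro a b ha hb rfl; rfl
  have hφsa : ∀ (x : A) (hx : x ∈ S), star x = x → star (φ ⟨x, hx⟩) = φ ⟨x, hx⟩ := by
    intro x hx hsx
    obtain ⟨r, hr, hp⟩ := MPos.unit (m := 1) (x := Matrix.of fun _ _ => x)
      (by ext i j; simpa using hsx)
    have hm : ∀ i j, ((r : ℂ) • (1 : Matrix (Fin 1) (Fin 1) A) +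
        (Matrix.of fun _ _ => x : Matrix (Fin 1) (Fin 1) A)) i j ∈ S :=
      fun i j => S.add_mem (S.smul_mem _ (hone 1 i j)) hx
    obtain h := MPos.isHerm (hφcp 1 _ hm hp)
    have h0 := congrFun (congrFun h 0) 0
    have e : φ ⟨_, hm 0 0⟩ = (r : ℂ) • (1 : B) + φ ⟨x, hx⟩ := by
      rw [← hφ1, ← map_smul, ← map_add]
      exact hφext _ _ _ _ (by simp)
    rw [Matrix.conjTranspose_apply, Matrix.of_apply, e] at h0
    simpa using h0
  have hφstar : ∀ (x : A) (hx : x ∈ S), star (φ ⟨x, hx⟩) = φ ⟨star x, hSstar x hx⟩ := by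
    intro x hx
    have h1 := hφsa (x + star x) (S.add_mem hx (hSstar x hx)) (by simp [add_comm])
    have h2 := hφsa (Complex.I • (x - star x)) (S.smul_mem _ (S.sub_mem hx (hSstar x hx)))
      (by simp [star_smul]; rw [← smul_neg, neg_sub])
    have e1 : φ ⟨x + star x, S.add_mem hx (hSstar x hx)⟩
        = φ ⟨x, hx⟩ + φ ⟨star x, hSstar x hx⟩ := by rw [← map_add]; rfl
    have e2 : φ ⟨Complex.I • (x - star x), S.smul_mem _ (S.sub_mem hx (hSstar x hx))⟩
        = Complex.I • (φ ⟨x, hx⟩ - φ ⟨star x, hSstar x hx⟩) := by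
      rw [← map_sub, ← map_smul]; rfl
    rw [e1] at h1
    rw [e2] at h2
    generalize φ ⟨x, hx⟩ = a at *
    generalize φ ⟨star x, hSstar x hx⟩ = b at *
    rw [star_add] at h1
    rw [star_smul, star_sub, RCLike.star_def, Complex.conj_I, neg_smul, ← smul_neg] at h2
    have h3 := smul_right_injective B Complex.I_ne_zero h2
    have h4 : (2 : ℂ) • star a = (2 : ℂ) • b := by
      have : star a = a + b - star b := by rw [← h1]; abel
      have h5 : star b = a - b + star a := by rw [← h3]; abel
      rw [h5] at this
      rw [two_smul, two_smul]
      nth_rw 1 [this]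
      abel
    exact smul_right_injective B (two_ne_zero' ℂ) h4
  have hJstar : ∀ x ∈ J, star x ∈ J := by
    intro x hx
    rw [← hker _ (hSstar x (hJS hx)), ← hφstar _ (hJS hx), (hker _ (hJS hx)).2 hx, star_zero]
  have hφpos : ∀ (m : ℕ) (x : Matrix (Fin m) (Fin m) A) (hx : quotCone S J m x) (ε : ℝ), 0 < ε →
      MPos ((ε : ℂ) • (1 : Matrix (Fin m) (Fin m) B) +
        Matrix.of fun i j => φ ⟨x i j, hx.1 i j⟩) := by
    intro m x hx ε hε
    obtain ⟨k, hk, hp⟩ := hx.2 ε hε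
    have hm : ∀ i j, ((ε : ℂ) • (1 : Matrix (Fin m) (Fin m) A) + (x + k)) i j ∈ S :=
      fun i j => S.add_mem (S.smul_mem _ (hone m i j)) (S.add_mem (hx.1 i j) (hJS (hk i j)))
    have h : MPos _ := hφcp m _ hm hp
    convert h using 1
    ext i j
    have e : φ ⟨_, hm i j⟩ = (ε : ℂ) • φ ⟨_, hone m i j⟩ + (φ ⟨_, hx.1 i j⟩ +
        φ ⟨_, hJS (hk i j)⟩) := by
      rw [← map_smul, ← map_add, ← map_add]; rfl
    rw [(hker _ _).2 (hk i j), add_zero] at e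
    rw [Matrix.of_apply, e, Matrix.add_apply, Matrix.of_apply, Matrix.smul_apply]
    congr 2
    by_cases hij : i = j
    · subst hij
      rw [Matrix.one_apply_eq, ← hφ1]
      exact hφext _ _ _ _ (by simp)
    · rw [Matrix.one_apply_ne hij, ← map_zero φ]
      exact hφext _ _ _ _ (by simp [hij])
  refine ⟨?_, ?_, ?_, ?_, ?_, ?_, ?_, hpos⟩
  · intro m x y hx hy
    refine ⟨fun i j => S.add_mem (hx.1 i j) (hy.1 i j), fun ε hε => ?_⟩
    obtain ⟨k, hk, hp⟩ := hx.2 (ε / 2) (by positivity)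
    obtain ⟨l, hl, hq⟩ := hy.2 (ε / 2) (by positivity)
    refine ⟨k + l, fun i j => J.add_mem (hk i j) (hl i j), ?_⟩
    have h := MPos.add hp hq
    have e : (ε : ℂ) = ((ε / 2 : ℝ) : ℂ) + ((ε / 2 : ℝ) : ℂ) := by push_cast; ring
    rw [e, add_smul]
    change MPos _
    convert h using 1
    abel
  · intro m r x hr hx
    have hm : ∀ i j, ((r : ℂ) • x) i j ∈ S := fun i j => S.smul_mem _ (hx.1 i j)
    rcases hr.eq_or_lt with rfl | hr
    · exact hpos m _ hm ⟨0, by simp⟩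
    refine ⟨hm, fun ε hε => ?_⟩
    obtain ⟨k, hk, hp⟩ := hx.2 (ε / r) (by positivity)
    refine ⟨(r : ℂ) • k, fun i j => J.smul_mem _ (hk i j), ?_⟩
    have h := MPos.smul hp hr.le
    rw [smul_add, smul_smul, smul_add, ← Complex.ofReal_mul, mul_div_cancel₀ _ hr.ne'] at h
    exact h
  · intro m m' α x hx
    refine ⟨conj_mem S hx.1 α, fun ε hε => ?_⟩
    set a : Matrix (Fin m) (Fin m') A := α.map (algebraMap ℂ A) with ha
    obtain ⟨r, hr, hu⟩ := MPos.unit (x := -(aᴴ * a)) (by simp)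
    obtain ⟨k, hk, hp⟩ := hx.2 (ε / r) (by positivity)
    refine ⟨aᴴ * k * a, conj_mem J hk α, ?_⟩
    have h := (MPos.conj hp a).add (MPos.smul hu (r := ε / r) (by positivity))
    change MPos _
    convert h using 1
    rw [smul_add, smul_smul, ← Complex.ofReal_mul, div_mul_cancel₀ _ hr.ne']
    simp only [Matrix.mul_add, Matrix.add_mul, Matrix.mul_smul, Matrix.smul_mul, Matrix.mul_one,
      smul_neg]
    abel
  · intro m x hx i j
    obtain ⟨k, hk, hp⟩ := hx.2 1 one_pos
    have h := congrFun (congrFun (MPos.isHerm hp) i) j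
    have e : x i j - star (x j i) = star (k j i) - k i j := by
      by_cases hij : i = j
      · subst hij
        simp at h
        rw [sub_eq_sub_iff_add_eq_add, ← h]; abel
      · simp [hij, Ne.symm hij] at h
        rw [sub_eq_sub_iff_add_eq_add, ← h]; abel
    rw [e]
    exact J.sub_mem (hJstar _ (hk j i)) (hk i j)
  · intro m x hx hx' i j
    have h := MPos.proper (hφpos m x hx) (fun ε hε => by
      convert hφpos m (-x) hx' ε hε using 2
      ext i j
      simp only [Matrix.neg_apply, Matrix.of_apply]
      rw [← map_neg]; rfl)
    exact (hker _ (hx.1 i j)).1 (congrFun (congrFun h i) j)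
  · intro m x hx hs
    obtain ⟨r, hr, hp⟩ := MPos.unit (x := x) (by ext i j; exact hs i j)
    exact ⟨r, hr, hpos m _ (fun i j => S.add_mem (S.smul_mem _ (hone m i j)) (hx i j)) hp⟩
  · intro m x hx h
    refine ⟨hx, fun ε hε => ?_⟩
    obtain ⟨k, hk, hp⟩ := (h (ε / 2) (by positivity)).2 (ε / 2) (by positivity)
    refine ⟨k, hk, ?_⟩
    have e : (ε : ℂ) = ((ε / 2 : ℝ) : ℂ) + ((ε / 2 : ℝ) : ℂ) := by push_cast; ring
    rw [e, add_smul]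
    convert hp using 2
    abel
end
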